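/- Let G be a connected claw-free block graph. For each block B of G let n(B) be the number of non-cut vertices of G lying in B, and let T be the tree obtained from 𝔹(G) by attaching n(B) pendant edges at the vertex B, for every block B. Then G is isomorphic to the line graph L(T). -/

import Mathlib

open SimpleGraph

/-- A set of vertices induces a connected subgraph with no cut vertex. -/
def NoCutVertexSet {V : Type*} (G : SimpleGraph V) (s : Set V) : Prop :=
  (G.induce s).Connected ∧
    ∀ v : s, ((G.induce s).induce {u : s | u ≠ v}).Preconnected

/-- A block of `G`: a maximal set of vertices inducing a connected subgraph without
cut vertices. -/
def IsBlock {V : Type*} (G : SimpleGraph V) (s : Set V) : Prop :=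
  NoCutVertexSet G s ∧ ∀ t : Set V, s ⊆ t → NoCutVertexSet G t → s = t

/-- A cut vertex: its removal disconnects the graph. -/
def IsCutVertex {V : Type*} (G : SimpleGraph V) (v : V) : Prop :=
  ¬ (G.induce {u : V | u ≠ v}).Preconnected

/-- The claw `K_{1,3}` with center `0`. -/
def clawGraph : SimpleGraph (Fin 4) :=
  SimpleGraph.fromRel fun a _ => a = 0

/-- The tree obtained from the block graph `𝔹(G)` by attaching, at each block `B`,
one pendant edge for every non-cut vertex of `G` lying in `B`. -/
def pendantTree {V : Type*} (G : SimpleGraph V) :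
    SimpleGraph ({s : Set V // IsBlock G s} ⊕ {v : V // ¬ IsCutVertex G v}) :=
  SimpleGraph.fromRel fun a b =>
    match a, b with
    | Sum.inl B, Sum.inl B' => ((B : Set V) ∩ (B' : Set V)).Nonempty
    | Sum.inl B, Sum.inr v => (v : V) ∈ (B : Set V)
    | _, _ => False

namespace SimpleGraph

variable {V N : Type*} {G : SimpleGraph V}

/-- Two vertices are joined by a walk all of whose vertices lie in `s`. -/
def ReachableIn (G : SimpleGraph V) (s : Set V) (x y : V) : Prop :=
  ∃ p : G.Walk x y, ∀ z ∈ p.support, z ∈ s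

namespace ReachableIn

variable {s t : Set V} {x y z : V}

lemma refl (hx : x ∈ s) : G.ReachableIn s x x := ⟨.nil, by simpa⟩

lemma symm (h : G.ReachableIn s x y) : G.ReachableIn s y x := by
  obtain ⟨p, hp⟩ := h
  exact ⟨p.reverse, by simpa using hp⟩

lemma trans (h : G.ReachableIn s x y) (h' : G.ReachableIn s y z) : G.ReachableIn s x z := by
  obtain ⟨p, hp⟩ := h
  obtain ⟨q, hq⟩ := h'
  exact ⟨p.append q, fun w hw => (Walk.mem_support_append_iff p q).1 hw |>.elim (hp w) (hq w)⟩

lemma of_adj (hx : x ∈ s) (hy : y ∈ s) (h : G.Adj x y) : G.ReachableIn s x y :=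
  ⟨.cons h .nil, by simp [hx, hy]⟩

lemma mono (hst : s ⊆ t) (h : G.ReachableIn s x y) : G.ReachableIn t x y := by
  obtain ⟨p, hp⟩ := h
  exact ⟨p, fun w hw => hst (hp w hw)⟩

end ReachableIn

lemma preconnected_induce_iff_reachableIn {s : Set V} :
    (G.induce s).Preconnected ↔ ∀ x ∈ s, ∀ y ∈ s, G.ReachableIn s x y := by
  constructor
  · intro h x hx y hy
    obtain ⟨p⟩ := h ⟨x, hx⟩ ⟨y, hy⟩
    refine ⟨p.map (Embedding.induce s).toHom, fun z hz => ?_⟩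
    obtain ⟨w, -, rfl⟩ := List.mem_map.1 ((Walk.support_map _ p).subst (motive := (z ∈ ·)) hz)
    exact w.2
  · rintro h ⟨x, hx⟩ ⟨y, hy⟩
    obtain ⟨p, hp⟩ := h x hx y hy
    exact ⟨p.induce s hp⟩

lemma reachableIn_induce_iff {s : Set V} {t : Set s} {x y : s} :
    (G.induce s).ReachableIn t x y ↔ G.ReachableIn (Subtype.val '' t) x y := by
  constructor
  · rintro ⟨p, hp⟩
    refine ⟨p.map (Embedding.induce s).toHom, fun z hz => ?_⟩
    obtain ⟨w, hw, rfl⟩ := List.mem_map.1 ((Walk.support_map _ p).subst (motive := (z ∈ ·)) hz)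
    exact ⟨w, hp w hw, rfl⟩
  · rintro ⟨p, hp⟩
    refine ⟨p.induce s fun z hz => ?_, fun z hz => ?_⟩
    · obtain ⟨w, -, rfl⟩ := hp z hz
      exact w.2
    · rw [Walk.support_induce, List.mem_attachWith] at hz
      obtain ⟨w, hw, h⟩ := hp z hz
      rwa [← Subtype.ext h]

lemma noCutVertexSet_iff {s : Set V} :
    NoCutVertexSet G s ↔ s.Nonempty ∧ (∀ x ∈ s, ∀ y ∈ s, G.ReachableIn s x y) ∧
      ∀ v ∈ s, ∀ x ∈ s, x ≠ v → ∀ y ∈ s, y ≠ v → G.ReachableIn (s \ {v}) x y := by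
  have key (v : s) : Subtype.val '' {u : s | u ≠ v} = s \ {(v : V)} := by
    ext x
    simp [Subtype.ext_iff, and_comm]
  rw [NoCutVertexSet, connected_iff, preconnected_induce_iff_reachableIn, Set.nonempty_coe_sort]
  simp only [preconnected_induce_iff_reachableIn, reachableIn_induce_iff, key, Subtype.forall,
    Set.mem_ofPred_eq, ne_eq, Subtype.mk.injEq]
  tauto

lemma isCutVertex_iff {v : V} :
    IsCutVertex G v ↔ ¬ ∀ x, x ≠ v → ∀ y, y ≠ v → G.ReachableIn {v}ᶜ x y := by
  rw [IsCutVertex, preconnected_induce_iff_reachableIn]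
  rfl

lemma IsClique.noCutVertexSet {s : Set V} (hs : G.IsClique s) (hne : s.Nonempty) :
    NoCutVertexSet G s := by
  have key (t : Set V) (ht : t ⊆ s) (x) (hx : x ∈ t) (y) (hy : y ∈ t) : G.ReachableIn t x y := by
    rcases eq_or_ne x y with rfl | hxy
    · exact .refl hx
    · exact .of_adj hx hy (hs (ht hx) (ht hy) hxy)
  exact noCutVertexSet_iff.2 ⟨hne, key s subset_rfl,
    fun v _ x hx hxv y hy hyv => key _ Set.sdiff_subset x ⟨hx, hxv⟩ y ⟨hy, hyv⟩⟩

/-- The union of a nonempty chain of sets without cut vertices has no cut vertex. -/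
lemma noCutVertexSet_sUnion {c : Set (Set V)} (hc : ∀ s ∈ c, NoCutVertexSet G s)
    (hchain : IsChain (· ⊆ ·) c) (hne : c.Nonempty) : NoCutVertexSet G (⋃₀ c) := by
  simp only [noCutVertexSet_iff] at hc ⊢
  have two {s t : Set V} (hs : s ∈ c) (ht : t ∈ c) : ∃ r ∈ c, s ⊆ r ∧ t ⊆ r :=
    hchain.directedOn s hs t ht
  refine ⟨?_, ?_, ?_⟩
  · obtain ⟨s, hs⟩ := hne
    obtain ⟨x, hx⟩ := (hc s hs).1
    exact ⟨x, s, hs, hx⟩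
  · rintro x ⟨s, hs, hx⟩ y ⟨t, ht, hy⟩
    obtain ⟨r, hr, hsr, htr⟩ := two hs ht
    exact ((hc r hr).2.1 x (hsr hx) y (htr hy)).mono (Set.subset_sUnion_of_mem hr)
  · rintro v ⟨q, hq, hv⟩ x ⟨s, hs, hx⟩ hxv y ⟨t, ht, hy⟩ hyv
    obtain ⟨r, hr, hsr, htr⟩ := two hs ht
    obtain ⟨r', hr', hrr, hqr⟩ := two hr hq
    exact ((hc r' hr').2.2 v (hqr hv) x (hrr (hsr hx)) hxv y (hrr (htr hy)) hyv).mono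
      (Set.sdiff_subset_sdiff_left (Set.subset_sUnion_of_mem hr'))

lemma _root_.NoCutVertexSet.exists_isBlock_superset {s : Set V} (hs : NoCutVertexSet G s) :
    ∃ t, s ⊆ t ∧ IsBlock G t := by
  obtain ⟨t, hst, ht⟩ := zorn_subset_nonempty {t | NoCutVertexSet G t}
    (fun c hc hchain hne => ⟨⋃₀ c, noCutVertexSet_sUnion hc hchain hne,
      fun _ => Set.subset_sUnion_of_mem⟩) s hs
  exact ⟨t, hst, ht.prop, fun r htr hr => ht.eq_of_subset hr htr⟩

lemma IsClique.exists_isBlock_superset {s : Set V} (hs : G.IsClique s) (hne : s.Nonempty) :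
    ∃ t, s ⊆ t ∧ IsBlock G t :=
  (hs.noCutVertexSet hne).exists_isBlock_superset

/-- A path together with a vertex adjacent to both of its ends has no cut vertex. -/
lemma Walk.IsPath.noCutVertexSet_insert {v u w : V} {p : G.Walk u w} (hp : p.IsPath)
    (hu : G.Adj v u) (hw : G.Adj v w) (hv : v ∉ p.support) :
    NoCutVertexSet G (insert v {x | x ∈ p.support}) := by
  classical
  set s : Set V := insert v {x | x ∈ p.support} with hs
  have star (t : Set V) (h : ∀ x ∈ t, G.ReachableIn t x v) (x) (hx : x ∈ t) (y) (hy : y ∈ t) :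
      G.ReachableIn t x y := (h x hx).trans (h y hy).symm
  have hvs : v ∈ s := Set.mem_insert _ _
  have reach (t : Set V) (hvt : v ∈ t) (x) (hx : x ∈ p.support)
      (h : (∀ z ∈ (p.takeUntil x hx).support, z ∈ t) ∨ ∀ z ∈ (p.dropUntil x hx).support, z ∈ t) :
      G.ReachableIn t x v := by
    rcases h with h | h
    · exact ReachableIn.trans (.symm ⟨p.takeUntil x hx, h⟩) (.of_adj (h _ (Walk.start_mem_support _)) hvt hu.symm)
    · exact ReachableIn.trans ⟨p.dropUntil x hx, h⟩ (.of_adj (h _ (Walk.end_mem_support _)) hvt hw.symm)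
  refine noCutVertexSet_iff.2 ⟨⟨v, hvs⟩, star s ?_, fun c hc x hx hxc y hy hyc => ?_⟩
  · rintro x (rfl | hx)
    · exact .refl hvs
    · exact reach s hvs x hx (.inl fun z hz => .inr (p.support_takeUntil_subset_support hx hz))
  · rcases eq_or_ne c v with rfl | hcv
    · have hsub (x) (hx : x ∈ s) (hxc : x ≠ c) : G.ReachableIn (s \ {c}) x u := by
        have hx := hx.resolve_left hxc
        refine ReachableIn.symm ⟨p.takeUntil x hx, fun z hz => ?_⟩
        have hz := p.support_takeUntil_subset_support hx hz
        exact ⟨.inr hz, fun h => hv (h ▸ hz)⟩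
      exact (hsub x hx hxc).trans (hsub y hy hyc).symm
    · refine star (s \ {c}) ?_ x ⟨hx, hxc⟩ y ⟨hy, hyc⟩
      rintro x ⟨rfl | hx, hxc⟩
      · exact .refl ⟨hvs, hcv.symm⟩
      refine reach (s \ {c}) ⟨hvs, hcv.symm⟩ x hx ?_
      by_cases h : c ∈ (p.takeUntil x hx).support
      · refine .inr fun z hz =>
          ⟨.inr (p.support_dropUntil_subset_support hx hz), fun hzc => ?_⟩
        obtain rfl : z = c := hzc
        have hnd := hp.support_nodup
        rw [← p.take_spec hx, Walk.support_append] at hnd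
        refine (List.nodup_append'.1 hnd).2.2 h ?_
        rw [← Walk.cons_tail_support] at hz
        exact (List.mem_cons.1 hz).resolve_left fun h => hxc h.symm
      · exact .inl fun z hz =>
          ⟨.inr (p.support_takeUntil_subset_support hx hz), fun hzc => h (hzc ▸ hz)⟩

lemma exists_isBlock_of_reachableIn_compl {v u w : V} (hu : G.Adj v u) (hw : G.Adj v w)
    (h : G.ReachableIn {v}ᶜ u w) : ∃ B, IsBlock G B ∧ v ∈ B ∧ u ∈ B ∧ w ∈ B := by
  classical
  obtain ⟨p, hp⟩ := h
  have hv : v ∉ (p.bypass).support := fun h => hp v (p.support_bypass_subset_support h) rfl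
  obtain ⟨B, hsB, hB⟩ := (p.bypass_isPath.noCutVertexSet_insert hu hw hv).exists_isBlock_superset
  exact ⟨B, hB, hsB (.inl rfl), hsB (.inr (Walk.start_mem_support _)),
    hsB (.inr (Walk.end_mem_support _))⟩

lemma Walk.exists_adj_reachableIn_compl {x v : V} (p : G.Walk x v) (hx : x ≠ v) :
    ∃ y, G.Adj v y ∧ G.ReachableIn {v}ᶜ x y := by
  induction p with
  | nil => exact absurd rfl hx
  | @cons x z v h p ih =>
    rcases eq_or_ne z v with rfl | hz
    · exact ⟨x, h.symm, .refl hx⟩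
    · obtain ⟨y, hy, hzy⟩ := ih hz
      exact ⟨y, hy, .trans (.of_adj hx hz h) hzy⟩

section IsBlock

variable {A B C : Set V} {u v w : V}

lemma _root_.IsBlock.nonempty (hB : IsBlock G B) : B.Nonempty := (noCutVertexSet_iff.1 hB.1).1

lemma _root_.IsBlock.exists_ne (hA : IsBlock G A) (hB : IsBlock G B) (hAB : A ≠ B)
    (hv : v ∈ B) : ∃ u ∈ A, u ≠ v := by
  by_contra! h
  exact hAB (hA.2 B (fun u hu => h u hu ▸ hv) hB.1)

variable (hblock : ∀ s : Set V, IsBlock G s → G.IsClique s)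
include hblock

lemma _root_.IsBlock.eq_of_mem (hA : IsBlock G A) (hB : IsBlock G B) (huv : u ≠ v)
    (huA : u ∈ A) (hvA : v ∈ A) (huB : u ∈ B) (hvB : v ∈ B) : A = B := by
  have hadj (x) (hx : x ∈ A) (y) (hy : y ∈ B) (hxy : x ≠ y) : G.Adj x y := by
    rcases eq_or_ne u x with rfl | hux
    · exact hblock B hB huB hy hxy
    rcases eq_or_ne u y with rfl | huy
    · exact hblock A hA hx huA hxy
    have hvx : x ≠ v → G.Adj x v := hblock A hA hx hvA
    have hvy : v ≠ y → G.Adj v y := hblock B hB hvB hy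
    have h : G.ReachableIn {u}ᶜ x y := by
      refine .trans (y := v) ?_ ?_
      · by_cases h : x = v
        · exact h ▸ .refl hux.symm
        · exact .of_adj hux.symm huv.symm (hvx h)
      · by_cases h : v = y
        · exact h ▸ .refl huv.symm
        · exact .of_adj huv.symm huy.symm (hvy h)
    obtain ⟨C, hC, -, hxC, hyC⟩ := exists_isBlock_of_reachableIn_compl
      (hblock A hA huA hx hux) (hblock B hB huB hy huy) h
    exact hblock C hC hxC hyC hxy
  have hclq : G.IsClique (A ∪ B) := by
    rintro x (hx | hx) y (hy | hy) hxy
    · exact hblock A hA hx hy hxy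
    · exact hadj x hx y hy hxy
    · exact (hadj y hy x hx hxy.symm).symm
    · exact hblock B hB hx hy hxy
  have hno := hclq.noCutVertexSet (hA.nonempty.mono Set.subset_union_left)
  exact (hA.2 _ Set.subset_union_left hno).trans (hB.2 _ Set.subset_union_right hno).symm

lemma _root_.IsBlock.eq_of_adj (hA : IsBlock G A) (hB : IsBlock G B)
    (hvA : v ∈ A) (hvB : v ∈ B) (hu : u ∈ A) (huv : u ≠ v) (hw : w ∈ B) (hwv : w ≠ v)
    (h : u = w ∨ G.Adj u w) : A = B := by
  rcases h with rfl | h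
  · exact hA.eq_of_mem hblock hB huv hu hvA hw hvB
  obtain ⟨C, hC, hvC, huC, hwC⟩ := exists_isBlock_of_reachableIn_compl
    (hblock A hA hvA hu huv.symm) (hblock B hB hvB hw hwv.symm)
    (.of_adj huv hwv h)
  exact (hA.eq_of_mem hblock hC huv hu hvA huC hvC).trans
    (hC.eq_of_mem hblock hB hwv hwC hvC hw hvB)

lemma eq_or_eq_or_eq_of_mem_isBlock
    (hclaw : ¬ ∃ s : Set V, Nonempty (G.induce s ≃g clawGraph))
    (hA : IsBlock G A) (hB : IsBlock G B) (hC : IsBlock G C)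
    (hvA : v ∈ A) (hvB : v ∈ B) (hvC : v ∈ C) : A = B ∨ A = C ∨ B = C := by
  by_contra! h
  obtain ⟨hAB, hAC, hBC⟩ := h
  obtain ⟨a, ha, hav⟩ := hA.exists_ne hB hAB hvB
  obtain ⟨b, hb, hbv⟩ := hB.exists_ne hC hBC hvC
  obtain ⟨c, hc, hcv⟩ := hC.exists_ne hA hAC.symm hvA
  have nab := fun h => hAB (hA.eq_of_adj hblock hB hvA hvB ha hav hb hbv h)
  have nac := fun h => hAC (hA.eq_of_adj hblock hC hvA hvC ha hav hc hcv h)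
  have nbc := fun h => hBC (hB.eq_of_adj hblock hC hvB hvC hb hbv hc hcv h)
  have va := hblock A hA hvA ha hav.symm
  have vb := hblock B hB hvB hb hbv.symm
  have vc := hblock C hC hvC hc hcv.symm
  rw [imp_false, not_or] at nab nac nbc
  let f : clawGraph ↪g G :=
    { toFun := ![v, a, b, c]
      inj' := by
        intro i j hij
        fin_cases i <;> fin_cases j <;> simp_all
      map_rel_iff' := by
        intro i j
        change G.Adj (![v, a, b, c] i) (![v, a, b, c] j) ↔ clawGraph.Adj i j
        fin_cases i <;> fin_cases j <;> simp_all [clawGraph, G.adj_comm] }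
  exact hclaw ⟨Set.range f, ⟨f.isoInduceRange.symm⟩⟩

/-- In a connected graph whose blocks are cliques, the cut vertices are the vertices lying in
more than one block. -/
lemma isCutVertex_iff_exists_isBlock_ne (hconn : G.Connected) (hB : IsBlock G B) (hv : v ∈ B) :
    IsCutVertex G v ↔ ∃ A, IsBlock G A ∧ v ∈ A ∧ A ≠ B := by
  rw [isCutVertex_iff]
  constructor
  · intro h
    by_contra! hun
    refine h fun x hx y hy => ?_
    obtain ⟨x', hvx, hxx⟩ := (hconn x v).some.exists_adj_reachableIn_compl hx
    obtain ⟨y', hvy, hyy⟩ := (hconn y v).some.exists_adj_reachableIn_compl hy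
    have mem (z) (hz : G.Adj v z) : z ∈ B := by
      obtain ⟨A, hsA, hA⟩ := IsClique.exists_isBlock_superset (G := G) (s := {v, z})
        (by simp [Set.pairwise_insert, hz, hz.symm]) (by simp)
      exact hun A hA (hsA (by simp)) ▸ hsA (by simp)
    refine (hxx.trans ?_).trans hyy.symm
    by_cases h : x' = y'
    · exact h ▸ .refl hvx.ne'
    · exact .of_adj hvx.ne' hvy.ne' (hblock B hB (mem _ hvx) (mem _ hvy) h)
  · rintro ⟨A, hA, hvA, hAB⟩ h
    obtain ⟨a, ha, hav⟩ := hA.exists_ne hB hAB hv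
    obtain ⟨b, hb, hbv⟩ := hB.exists_ne hA hAB.symm hvA
    obtain ⟨C, hC, hvC, haC, hbC⟩ := exists_isBlock_of_reachableIn_compl
      (hblock A hA hvA ha hav.symm) (hblock B hB hv hb hbv.symm) (h a hav b hbv)
    exact hAB ((hA.eq_of_mem hblock hC hav ha hvA haC hvC).trans
      (hC.eq_of_mem hblock hB hbv hbC hvC hb hv))

end IsBlock

section RootGraph

variable {T : SimpleGraph N} {e : V → Sym2 N}
  (hT : ∀ a b, T.Adj a b ↔ ∃ v, e v = s(a, b)) (hinj : Function.Injective e)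
  (hG : ∀ u v, G.Adj u v ↔ u ≠ v ∧ ∃ c, c ∈ e u ∧ c ∈ e v)
include hT

include hG in
lemma preconnected_of_edge_labelling (hconn : G.Preconnected) (hne : ∀ a, ∃ v, a ∈ e v) :
    T.Preconnected := by
  have same (v : V) (a b : N) (ha : a ∈ e v) (hb : b ∈ e v) : T.Reachable a b := by
    by_cases h : a = b
    · exact h ▸ .rfl
    · exact ((hT a b).2 ⟨v, (Sym2.mem_and_mem_iff h).1 ⟨ha, hb⟩⟩).reachable
  have walk {u v : V} (p : G.Walk u v) (a b : N) (ha : a ∈ e u) (hb : b ∈ e v) :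
      T.Reachable a b := by
    induction p generalizing a with
    | nil => exact same _ a b ha hb
    | cons h p ih =>
      obtain ⟨-, c, hc, hc'⟩ := (hG _ _).1 h
      exact (same _ a c ha hc).trans (ih c hc' hb)
  intro a b
  obtain ⟨u, hu⟩ := hne a
  obtain ⟨v, hv⟩ := hne b
  exact walk (hconn u v).some a b hu hv

include hinj hG

lemma nonempty_iso_lineGraph_of_edge_labelling (hdiag : ∀ v, ¬ (e v).IsDiag) :
    Nonempty (G ≃g T.lineGraph) := by
  have hmem (v : V) : e v ∈ T.edgeSet := by
    have hd := hdiag v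
    rcases h : e v with ⟨a, b⟩
    exact (hT a b).2 ⟨v, h⟩
  let f : V → T.edgeSet := fun v => ⟨e v, hmem v⟩
  have hf : Function.Bijective f := by
    refine ⟨fun u v h => hinj (congrArg Subtype.val h), ?_⟩
    rintro ⟨⟨a, b⟩, h⟩
    obtain ⟨v, hv⟩ := (hT a b).1 h
    exact ⟨v, Subtype.ext hv⟩
  refine ⟨⟨Equiv.ofBijective f hf, ?_⟩⟩
  intro u v
  rw [hG]
  exact and_congr hf.1.ne_iff Iff.rfl

lemma isAcyclic_of_edge_labelling
    (hK : ∀ v u w, G.Adj v u → G.Adj v w → G.ReachableIn {v}ᶜ u w →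
      ∃ c, c ∈ e v ∧ c ∈ e u ∧ c ∈ e w) :
    T.IsAcyclic := by
  refine isAcyclic_iff_forall_adj_isBridge.2 fun a b hab => ?_
  obtain ⟨v, hv⟩ := (hT a b).1 hab
  rw [isBridge_iff]
  intro hreach
  have eq_v (x) (hx : a ∈ e x) (hx' : b ∈ e x) : x = v :=
    hinj (((Sym2.mem_and_mem_iff hab.ne).1 ⟨hx, hx'⟩).trans hv.symm)
  have label {c d : N} (h : (T.deleteEdges {s(a, b)}).Adj c d) : ∃ w, w ≠ v ∧ e w = s(c, d) := by
    rw [deleteEdges_adj] at h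
    obtain ⟨w, hw⟩ := (hT c d).1 h.1
    exact ⟨w, fun hwv => h.2 (by rw [← hw, hwv, hv]; rfl), hw⟩
  have inv (c : N) (h : Relation.ReflTransGen (T.deleteEdges {s(a, b)}).Adj a c) :
      ∀ x, x ≠ v → c ∈ e x → ∃ y, y ≠ v ∧ a ∈ e y ∧ G.ReachableIn {v}ᶜ y x := by
    induction h with
    | refl => exact fun x hx hax => ⟨x, hx, hax, .refl hx⟩
    | @tail c d _ hcd ih =>
      intro x hx hdx
      obtain ⟨w, hwv, hw⟩ := label hcd
      obtain ⟨y, hyv, hay, hyw⟩ := ih w hwv (by simp [hw])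
      refine ⟨y, hyv, hay, hyw.trans ?_⟩
      by_cases h : w = x
      · exact h ▸ .refl hwv
      · exact .of_adj hwv hx ((hG w x).2 ⟨h, d, by simp [hw], hdx⟩)
  rw [reachable_iff_reflTransGen] at hreach
  obtain h | ⟨c, -, hcb⟩ := hreach.cases_tail
  · exact hab.ne h.symm
  obtain ⟨x, hxv, hx⟩ := label hcb
  have hbx : b ∈ e x := by simp [hx]
  obtain ⟨y, hyv, hay, hyx⟩ := inv b hreach x hxv hbx
  obtain ⟨d, hdv, hdy, hdx⟩ := hK v y x
    ((hG v y).2 ⟨hyv.symm, a, by simp [hv], hay⟩)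
    ((hG v x).2 ⟨hxv.symm, b, by simp [hv], hbx⟩) hyx
  rw [hv, Sym2.mem_iff] at hdv
  rcases hdv with rfl | rfl
  · exact hxv (eq_v x hdx hbx)
  · exact hyv (eq_v y hay hdy)

end RootGraph

/-- The set of vertices of `G` represented by edges of `pendantTree G` at the given node. -/
def pendantTreeStar (G : SimpleGraph V) :
    {s : Set V // IsBlock G s} ⊕ {v : V // ¬ IsCutVertex G v} → Set V
  | .inl B => B
  | .inr v => {(v : V)}

lemma pendantTree_adj_iff (a b : {s : Set V // IsBlock G s} ⊕ {v : V // ¬ IsCutVertex G v}) :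
    (pendantTree G).Adj a b ↔
      a ≠ b ∧ (pendantTreeStar G a ∩ pendantTreeStar G b).Nonempty := by
  rcases a with A | x <;> rcases b with B | y <;>
    simp [pendantTree, pendantTreeStar, Set.inter_comm, Subtype.ext_iff, eq_comm]

section Pendant

variable (hconn : G.Connected) (hblock : ∀ s : Set V, IsBlock G s → G.IsClique s)
include hblock

lemma eq_of_mem_pendantTreeStar
    {a b : {s : Set V // IsBlock G s} ⊕ {v : V // ¬ IsCutVertex G v}} (hab : a ≠ b) {u v : V}
    (hua : u ∈ pendantTreeStar G a) (hub : u ∈ pendantTreeStar G b)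
    (hva : v ∈ pendantTreeStar G a) (hvb : v ∈ pendantTreeStar G b) : u = v := by
  rcases a with A | x
  · rcases b with B | y
    · by_contra huv
      exact hab (congrArg _ (Subtype.ext (A.2.eq_of_mem hblock B.2 huv hua hva hub hvb)))
    · exact hub.trans hvb.symm
  · exact hua.trans hva.symm

include hconn

lemma exists_sym2_forall_mem_iff_mem_pendantTreeStar
    (hclaw : ¬ ∃ s : Set V, Nonempty (G.induce s ≃g clawGraph)) (v : V) :
    ∃ e : Sym2 ({s : Set V // IsBlock G s} ⊕ {v : V // ¬ IsCutVertex G v}),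
      ¬ e.IsDiag ∧ ∀ c, c ∈ e ↔ v ∈ pendantTreeStar G c := by
  obtain ⟨B, hvB, hB⟩ := IsClique.exists_isBlock_superset (G := G) (s := {v}) (by simp) (by simp)
  rw [Set.singleton_subset_iff] at hvB
  have hcut := isCutVertex_iff_exists_isBlock_ne hblock hconn hB hvB
  by_cases hv : IsCutVertex G v
  · obtain ⟨A, hA, hvA, hAB⟩ := hcut.1 hv
    refine ⟨s(.inl ⟨A, hA⟩, .inl ⟨B, hB⟩), by simpa using hAB, ?_⟩
    rintro (⟨C, hC⟩ | ⟨x, hx⟩)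
    · simp only [Sym2.mem_iff, Sum.inl.injEq, Subtype.mk.injEq, pendantTreeStar]
      refine ⟨by rintro (rfl | rfl) <;> assumption, fun hvC => ?_⟩
      have := eq_or_eq_or_eq_of_mem_isBlock hblock hclaw hA hB hC hvA hvB hvC
      grind
    · simp only [Sym2.mem_iff, reduceCtorEq, or_self, pendantTreeStar, Set.mem_singleton_iff,
        false_iff]
      rintro rfl
      exact hx hv
  · refine ⟨s(.inl ⟨B, hB⟩, .inr ⟨v, hv⟩), by simp, ?_⟩
    rintro (⟨C, hC⟩ | ⟨x, hx⟩)
    · simp only [Sym2.mem_iff, Sum.inl.injEq, Subtype.mk.injEq, reduceCtorEq, or_false,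
        pendantTreeStar]
      refine ⟨by rintro rfl; assumption, fun hvC => ?_⟩
      by_contra h
      exact hv (hcut.2 ⟨C, hC, hvC, h⟩)
    · simp [pendantTreeStar, eq_comm]

end Pendant

end SimpleGraph

theorem stmt_15 {V : Type*} (G : SimpleGraph V) (hconn : G.Connected)
    (hblock : ∀ s : Set V, IsBlock G s → G.IsClique s)
    (hclaw : ¬ ∃ s : Set V, Nonempty (G.induce s ≃g clawGraph)) :
    (pendantTree G).IsTree ∧ Nonempty (G ≃g (pendantTree G).lineGraph) := by
  choose e hdiag he using exists_sym2_forall_mem_iff_mem_pendantTreeStar hconn hblock hclaw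
  have hT (a b) : (pendantTree G).Adj a b ↔ ∃ v, e v = s(a, b) := by
    rw [pendantTree_adj_iff]
    constructor
    · rintro ⟨hab, v, ha, hb⟩
      exact ⟨v, (Sym2.mem_and_mem_iff hab).1 ⟨(he v a).2 ha, (he v b).2 hb⟩⟩
    · rintro ⟨v, hv⟩
      have hd := hdiag v
      rw [hv, Sym2.mk_isDiag_iff] at hd
      exact ⟨hd, v, (he v a).1 (by simp [hv]), (he v b).1 (by simp [hv])⟩
  have hinj : Function.Injective e := by
    intro u v huv
    have hd := hdiag u
    rcases h : e u with ⟨a, b⟩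
    have h : e u = s(a, b) := h
    have h' : e v = s(a, b) := huv.symm.trans h
    rw [h, Sym2.mk_isDiag_iff] at hd
    exact eq_of_mem_pendantTreeStar hblock hd ((he u a).1 (by simp [h]))
      ((he u b).1 (by simp [h])) ((he v a).1 (by simp [h'])) ((he v b).1 (by simp [h']))
  have hG (u v) : G.Adj u v ↔ u ≠ v ∧ ∃ c, c ∈ e u ∧ c ∈ e v := by
    simp only [he]
    constructor
    · intro h
      obtain ⟨B, hsB, hB⟩ := IsClique.exists_isBlock_superset (G := G) (s := {u, v})
        (by simp [Set.pairwise_insert, h, h.symm]) (by simp)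
      exact ⟨h.ne, .inl ⟨B, hB⟩, hsB (by simp), hsB (by simp)⟩
    · rintro ⟨huv, B | x, hu, hv⟩
      · exact hblock B B.2 hu hv huv
      · exact absurd (hu.trans hv.symm) huv
  have hne (a) : ∃ v, a ∈ e v := by
    simp only [he]
    rcases a with B | x
    · exact B.2.nonempty
    · exact ⟨x, rfl⟩
  have : Nonempty V := hconn.nonempty
  have : Nonempty ({s : Set V // IsBlock G s} ⊕ {v : V // ¬ IsCutVertex G v}) :=
    this.map fun v => (e v).out.1
  refine ⟨⟨⟨preconnected_of_edge_labelling hT hG hconn.preconnected hne⟩,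
    isAcyclic_of_edge_labelling hT hinj hG fun v u w hu hw h => ?_⟩,
    nonempty_iso_lineGraph_of_edge_labelling hT hinj hG hdiag⟩
  obtain ⟨B, hB, hvB, huB, hwB⟩ := exists_isBlock_of_reachableIn_compl hu hw h
  exact ⟨.inl ⟨B, hB⟩, (he _ _).2 hvB, (he _ _).2 huB, (he _ _).2 hwB⟩
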